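/- Let A be a commutative bigraded bidifferential algebra over ℂ, with d = ∂ + ∂̄ and d^c = (1/2)(∂̄ − ∂). Then: (1) d∘d^c = ∂∂̄ as operators on A. Moreover, let α, β, γ ∈ A be homogeneous of total degrees k₁, k₂, k₃ with ∂α = ∂̄α = 0, ∂β = ∂̄β = 0, ∂γ = ∂̄γ = 0, and x, y ∈ A homogeneous with αβ = i∂∂̄x and βγ = i∂∂̄y. Then: (2) d(i·d^c x) = αβ and d(i·d^c y) = βγ; (3) i·d^c(αy − xγ) = (−1)^{k₁}·α·(i·d^c y) − (i·d^c x)·γ; (4) this element is d-closed. In other words, d^c maps (up to the factor −i) the Aeppli–Bott–Chern–Massey representative αy − xγ to a representative (−1)^{k₁}αY − Xγ of the ordinary triple Massey product of α, β, γ built from the d-primitives X = i·d^c x, Y = i·d^c y. -/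

import Mathlib

/-- A commutative bigraded bidifferential algebra (cbba) over `ℂ`: an `(ℕ × ℕ)`-graded
associative unital `ℂ`-algebra `A = ⊕_{p,q} A^{p,q}`, graded-commutative with respect to the
total degree, with `ℂ`-linear maps `∂ : A^{p,q} → A^{p+1,q}` (here `D`) and
`∂̄ : A^{p,q} → A^{p,q+1}` (here `Dbar`) satisfying `∂² = 0`, `∂̄² = 0`, `∂∂̄ + ∂̄∂ = 0`, and
the graded Leibniz rules. -/
structure CBBA where
  A : Type
  [ringA : Ring A]
  [algA : Algebra ℂ A]
  /-- the bigrading `A^{p,q}` -/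
  gr : ℕ → ℕ → Submodule ℂ A
  /-- `A` is the internal direct sum of the `A^{p,q}` -/
  internal : DirectSum.IsInternal (fun pq : ℕ × ℕ => gr pq.1 pq.2)
  one_mem : (1 : A) ∈ gr 0 0
  mul_mem : ∀ {p q p' q' : ℕ} {a b : A}, a ∈ gr p q → b ∈ gr p' q' →
      a * b ∈ gr (p + p') (q + q')
  /-- graded commutativity with respect to the total degree -/
  comm : ∀ {p q p' q' : ℕ} {a b : A}, a ∈ gr p q → b ∈ gr p' q' →
      a * b = ((-1 : ℂ) ^ ((p + q) * (p' + q'))) • (b * a)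
  /-- the operator `∂` -/
  D : A →ₗ[ℂ] A
  /-- the operator `∂̄` -/
  Dbar : A →ₗ[ℂ] A
  D_mem : ∀ {p q : ℕ} {a : A}, a ∈ gr p q → D a ∈ gr (p + 1) q
  Dbar_mem : ∀ {p q : ℕ} {a : A}, a ∈ gr p q → Dbar a ∈ gr p (q + 1)
  D_sq : ∀ a : A, D (D a) = 0
  Dbar_sq : ∀ a : A, Dbar (Dbar a) = 0
  anticomm : ∀ a : A, D (Dbar a) + Dbar (D a) = 0
  leibniz_D : ∀ {p q : ℕ} {a : A}, a ∈ gr p q → ∀ b : A,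
      D (a * b) = D a * b + ((-1 : ℂ) ^ (p + q)) • (a * D b)
  leibniz_Dbar : ∀ {p q : ℕ} {a : A}, a ∈ gr p q → ∀ b : A,
      Dbar (a * b) = Dbar a * b + ((-1 : ℂ) ^ (p + q)) • (a * Dbar b)

attribute [instance] CBBA.ringA CBBA.algA

/-- An element of a cbba is homogeneous of total degree `k` if it lies in
`A^k = ⊕_{p+q=k} A^{p,q}`. -/
def CBBA.Homog (C : CBBA) (a : C.A) (k : ℕ) : Prop :=
  a ∈ ⨆ (p : ℕ) (q : ℕ) (_ : p + q = k), C.gr p q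

namespace CBBA

variable (C : CBBA)

/-- The graded Leibniz rule extends from pure bidegrees to elements homogeneous in total degree. -/
theorem leibniz_D_of_homog {a : C.A} {k : ℕ} (ha : C.Homog a k) (b : C.A) :
    C.D (a * b) = C.D a * b + ((-1 : ℂ) ^ k) • (a * C.D b) := by
  let F : C.A →ₗ[ℂ] C.A := C.D ∘ₗ LinearMap.mulRight ℂ b
  let G : C.A →ₗ[ℂ] C.A :=
    LinearMap.mulRight ℂ b ∘ₗ C.D + ((-1 : ℂ) ^ k) • LinearMap.mulRight ℂ (C.D b)
  suffices h : (⨆ (p : ℕ) (q : ℕ) (_ : p + q = k), C.gr p q) ≤ LinearMap.eqLocus F G from h ha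
  refine iSup_le fun p => iSup_le fun q => iSup_le fun hpq c hc => ?_
  subst hpq
  exact C.leibniz_D hc b

theorem leibniz_Dbar_of_homog {a : C.A} {k : ℕ} (ha : C.Homog a k) (b : C.A) :
    C.Dbar (a * b) = C.Dbar a * b + ((-1 : ℂ) ^ k) • (a * C.Dbar b) := by
  let F : C.A →ₗ[ℂ] C.A := C.Dbar ∘ₗ LinearMap.mulRight ℂ b
  let G : C.A →ₗ[ℂ] C.A :=
    LinearMap.mulRight ℂ b ∘ₗ C.Dbar + ((-1 : ℂ) ^ k) • LinearMap.mulRight ℂ (C.Dbar b)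
  suffices h : (⨆ (p : ℕ) (q : ℕ) (_ : p + q = k), C.gr p q) ≤ LinearMap.eqLocus F G from h ha
  refine iSup_le fun p => iSup_le fun q => iSup_le fun hpq c hc => ?_
  subst hpq
  exact C.leibniz_Dbar hc b

theorem D_mul_of_D_right_eq_zero (a : C.A) {b : C.A} (hb : C.D b = 0) :
    C.D (a * b) = C.D a * b := by
  suffices h : (⊤ : Submodule ℂ C.A) ≤ LinearMap.eqLocus
      (C.D ∘ₗ LinearMap.mulRight ℂ b) (LinearMap.mulRight ℂ b ∘ₗ C.D) from
    h (Submodule.mem_top (x := a))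
  rw [← C.internal.submodule_iSup_eq_top]
  refine iSup_le fun pq a ha => ?_
  simpa [hb] using C.leibniz_D ha b

theorem Dbar_mul_of_Dbar_right_eq_zero (a : C.A) {b : C.A} (hb : C.Dbar b = 0) :
    C.Dbar (a * b) = C.Dbar a * b := by
  suffices h : (⊤ : Submodule ℂ C.A) ≤ LinearMap.eqLocus
      (C.Dbar ∘ₗ LinearMap.mulRight ℂ b) (LinearMap.mulRight ℂ b ∘ₗ C.Dbar) from
    h (Submodule.mem_top (x := a))
  rw [← C.internal.submodule_iSup_eq_top]
  refine iSup_le fun pq a ha => ?_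
  simpa [hb] using C.leibniz_Dbar ha b

/-- `d ∘ dᶜ = ∂∂̄`. -/
theorem d_dc_apply (a : C.A) :
    (C.D + C.Dbar) (((2⁻¹ : ℂ) • (C.Dbar - C.D)) a) = C.D (C.Dbar a) := by
  have h : C.Dbar (C.D a) = -C.D (C.Dbar a) := eq_neg_of_add_eq_zero_right (C.anticomm a)
  simp only [LinearMap.add_apply, LinearMap.smul_apply, LinearMap.sub_apply, map_smul, map_sub,
    C.D_sq, C.Dbar_sq, h]
  module

end CBBA

/-- With `d = ∂ + ∂̄` and `dᶜ = ½(∂̄ − ∂)`: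
(1) `d ∘ dᶜ = ∂∂̄` as operators on `A`;
and for `∂`,`∂̄`-closed homogeneous `α, β, γ` of total degrees `k₁, k₂, k₃` and homogeneous
`x, y` with `αβ = i∂∂̄x`, `βγ = i∂∂̄y`:
(2) `d(i·dᶜx) = αβ` and `d(i·dᶜy) = βγ`;
(3) `i·dᶜ(αy − xγ) = (−1)^{k₁}·α·(i·dᶜy) − (i·dᶜx)·γ`;
(4) this element is `d`-closed.
Thus `dᶜ` maps (up to the factor `−i`) the ABC-Massey representative `αy − xγ` to a
representative `(−1)^{k₁}αY − Xγ` of the ordinary triple Massey product built from the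
`d`-primitives `X = i·dᶜx`, `Y = i·dᶜy`. -/
theorem dc_of_abc_massey_is_ordinary_massey (C : CBBA)
    (k₁ k₂ k₃ l₁ l₂ : ℕ) (α β γ x y : C.A)
    (hα : C.Homog α k₁) (hβ : C.Homog β k₂) (hγ : C.Homog γ k₃)
    (hx : C.Homog x l₁) (hy : C.Homog y l₂)
    (hαD : C.D α = 0) (hαDb : C.Dbar α = 0)
    (hβD : C.D β = 0) (hβDb : C.Dbar β = 0)
    (hγD : C.D γ = 0) (hγDb : C.Dbar γ = 0)
    (hxab : α * β = Complex.I • C.D (C.Dbar x))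
    (hybc : β * γ = Complex.I • C.D (C.Dbar y)) :
    -- (1) d ∘ dᶜ = ∂∂̄
    ((C.D + C.Dbar) ∘ₗ ((2⁻¹ : ℂ) • (C.Dbar - C.D)) = C.D ∘ₗ C.Dbar) ∧
    -- (2) i·dᶜx and i·dᶜy are d-primitives of αβ and βγ
    ((C.D + C.Dbar) (Complex.I • ((2⁻¹ : ℂ) • (C.Dbar - C.D)) x) = α * β ∧
     (C.D + C.Dbar) (Complex.I • ((2⁻¹ : ℂ) • (C.Dbar - C.D)) y) = β * γ) ∧
    -- (3) i·dᶜ(αy − xγ) = (−1)^{k₁} α (i·dᶜy) − (i·dᶜx) γ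
    (Complex.I • ((2⁻¹ : ℂ) • (C.Dbar - C.D)) (α * y - x * γ)
      = ((-1 : ℂ) ^ k₁) • (α * (Complex.I • ((2⁻¹ : ℂ) • (C.Dbar - C.D)) y))
        - (Complex.I • ((2⁻¹ : ℂ) • (C.Dbar - C.D)) x) * γ) ∧
    -- (4) it is d-closed
    (C.D + C.Dbar) (Complex.I • ((2⁻¹ : ℂ) • (C.Dbar - C.D)) (α * y - x * γ)) = 0 := by
  have hd : ∀ a : C.A, (C.D + C.Dbar) (Complex.I • ((2⁻¹ : ℂ) • (C.Dbar - C.D)) a)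
      = Complex.I • C.D (C.Dbar a) := fun a => by rw [map_smul, C.d_dc_apply]
  have hDα : ∀ b, C.D (α * b) = ((-1 : ℂ) ^ k₁) • (α * C.D b) := fun b => by
    rw [C.leibniz_D_of_homog hα, hαD, zero_mul, zero_add]
  have hDbα : ∀ b, C.Dbar (α * b) = ((-1 : ℂ) ^ k₁) • (α * C.Dbar b) := fun b => by
    rw [C.leibniz_Dbar_of_homog hα, hαDb, zero_mul, zero_add]
  have hDγ := fun a => C.D_mul_of_D_right_eq_zero a hγD
  have hDbγ := fun a => C.Dbar_mul_of_Dbar_right_eq_zero a hγDb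
  refine ⟨LinearMap.ext C.d_dc_apply, ⟨(hd x).trans hxab.symm, (hd y).trans hybc.symm⟩, ?_, ?_⟩
  · simp only [LinearMap.smul_apply, LinearMap.sub_apply, map_sub, hDα, hDbα, hDγ, hDbγ,
      mul_smul_comm, smul_mul_assoc, mul_sub, sub_mul]
    module
  · have hsign : ((-1 : ℂ) ^ k₁) * (-1) ^ k₁ = 1 := by rw [← mul_pow]; simp
    rw [hd, map_sub, map_sub, hDbα, hDbγ, map_smul, hDα, hDγ, smul_smul, hsign, one_smul,
      smul_sub, ← mul_smul_comm, ← smul_mul_assoc, ← hxab, ← hybc, mul_assoc, sub_self]
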